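/- Let m, σ > 0, α > 1, and let q, q' ∈ ℝ with Δ' = |q - q'| > 0. Then the Rényi divergence of order α between the OSGT densities at locations q and q' is given exactly by (1/(α-1))·log ∫_{ℝ} f_q(y)^α · f_{q'}(y)^{1-α} dy = α·Δ'²/(2σ²) + (1/(α-1))·log((√(2πσ²)/S)·B), where B = Φ((-m + (α-1)Δ')/σ) + Φ((-m - αΔ')/σ) + exp(α(α-1)(4mΔ' + 4m²)/(2σ²))·(Φ((αΔ' - m(1-2α))/σ) - Φ(((α-1)Δ' - m(1-2α))/σ)). -/

import Mathlib

open MeasureTheory Real Filter Set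

/-- The Gaussian Q-function: `Q x = (1/√(2π)) ∫_x^∞ exp (-t²/2) dt`. -/
noncomputable def gaussQ (x : ℝ) : ℝ :=
  (1 / Real.sqrt (2 * Real.pi)) * ∫ t in Set.Ioi x, Real.exp (-t ^ 2 / 2)

/-- The standard normal CDF: `Φ x = (1/√(2π)) ∫_{-∞}^x exp (-t²/2) dt`. -/
noncomputable def stdPhi (x : ℝ) : ℝ :=
  (1 / Real.sqrt (2 * Real.pi)) * ∫ t in Set.Iic x, Real.exp (-t ^ 2 / 2)

/-- The offset-symmetric Gaussian tails (OSGT) density with parameters `m`, `σ`,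
with normalization constant `S = 2√(2πσ²) Q(m/σ)`. -/
noncomputable def osgt (m σ y : ℝ) : ℝ :=
  if y ≤ 0 then
    Real.exp (-(y - m) ^ 2 / (2 * σ ^ 2)) /
      (2 * Real.sqrt (2 * Real.pi * σ ^ 2) * gaussQ (m / σ))
  else
    Real.exp (-(y + m) ^ 2 / (2 * σ ^ 2)) /
      (2 * Real.sqrt (2 * Real.pi * σ ^ 2) * gaussQ (m / σ))

lemma integrable_exp_neg_sub_sq_div (c : ℝ) {σ : ℝ} (hσ : 0 < σ) :
    Integrable fun y : ℝ => Real.exp (-(y - c) ^ 2 / (2 * σ ^ 2)) := by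
  have h := (integrable_exp_neg_mul_sq (b := 1 / (2 * σ ^ 2)) (by positivity)).comp_sub_right c
  refine h.congr (Eventually.of_forall fun y => ?_)
  simp only
  congr 1
  ring

lemma integrable_exp_neg_sq_div_two : Integrable fun t : ℝ => Real.exp (-t ^ 2 / 2) := by
  simpa using integrable_exp_neg_sub_sq_div 0 one_pos

lemma gaussQ_pos (x : ℝ) : 0 < gaussQ x := by
  have : NeZero (volume.restrict (Ioi x)) := ⟨by simp [Measure.restrict_eq_zero]⟩
  have h := integral_exp_pos (μ := volume.restrict (Ioi x)) (f := fun t : ℝ => -t ^ 2 / 2)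
    integrable_exp_neg_sq_div_two.integrableOn
  unfold gaussQ
  positivity

lemma stdPhi_pos (x : ℝ) : 0 < stdPhi x := by
  have : NeZero (volume.restrict (Iic x)) := ⟨by simp [Measure.restrict_eq_zero]⟩
  have h := integral_exp_pos (μ := volume.restrict (Iic x)) (f := fun t : ℝ => -t ^ 2 / 2)
    integrable_exp_neg_sq_div_two.integrableOn
  unfold stdPhi
  positivity

lemma stdPhi_mono : Monotone stdPhi := by
  intro x y hxy
  unfold stdPhi
  refine mul_le_mul_of_nonneg_left ?_ (by positivity)
  exact setIntegral_mono_set integrable_exp_neg_sq_div_two.integrableOn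
    (Eventually.of_forall fun t => (Real.exp_pos _).le) (Iic_subset_Iic.2 hxy).eventuallyLE

lemma setIntegral_Iic_exp_neg_sub_sq_div (a c : ℝ) {σ : ℝ} (hσ : 0 < σ) :
    ∫ y in Iic a, Real.exp (-(y - c) ^ 2 / (2 * σ ^ 2)) =
      Real.sqrt (2 * Real.pi * σ ^ 2) * stdPhi ((a - c) / σ) := by
  set H : ℝ → ℝ := (Iic ((a - c) / σ)).indicator fun t => Real.exp (-t ^ 2 / 2) with hH
  have h₁ : ∫ y in Iic a, Real.exp (-(y - c) ^ 2 / (2 * σ ^ 2)) = ∫ y, H ((y - c) / σ) := by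
    rw [← integral_indicator measurableSet_Iic]
    congr 1
    ext y
    simp only [hH, indicator, mem_Iic, div_le_div_iff_of_pos_right hσ, sub_le_sub_iff_right]
    split_ifs
    · congr 1
      field_simp
    · rfl
  rw [h₁, integral_sub_right_eq_self (fun y => H (y / σ)) c, Measure.integral_comp_div H σ, hH,
    integral_indicator measurableSet_Iic, stdPhi, abs_of_pos hσ, Real.sqrt_mul (by positivity),
    Real.sqrt_sq hσ.le, smul_eq_mul]
  have : Real.sqrt (2 * Real.pi) ≠ 0 := by positivity
  field_simp

lemma setIntegral_Ioi_exp_neg_sub_sq_div (a c : ℝ) {σ : ℝ} (hσ : 0 < σ) :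
    ∫ y in Ioi a, Real.exp (-(y - c) ^ 2 / (2 * σ ^ 2)) =
      Real.sqrt (2 * Real.pi * σ ^ 2) * stdPhi ((c - a) / σ) := by
  have h := integral_comp_neg_Ioi a fun y => Real.exp (-(y - -c) ^ 2 / (2 * σ ^ 2))
  rw [setIntegral_Iic_exp_neg_sub_sq_div _ _ hσ] at h
  rw [show (c - a) / σ = (-a - -c) / σ by ring, ← h]
  congr 1
  ext y
  congr 2
  ring

lemma setIntegral_Ioc_exp_neg_sub_sq_div {a b : ℝ} (hab : a ≤ b) (c : ℝ) {σ : ℝ} (hσ : 0 < σ) :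
    ∫ y in Ioc a b, Real.exp (-(y - c) ^ 2 / (2 * σ ^ 2)) =
      Real.sqrt (2 * Real.pi * σ ^ 2) * (stdPhi ((b - c) / σ) - stdPhi ((a - c) / σ)) := by
  have hi := integrable_exp_neg_sub_sq_div c hσ
  rw [mul_sub, ← setIntegral_Iic_exp_neg_sub_sq_div b c hσ,
    ← setIntegral_Iic_exp_neg_sub_sq_div a c hσ,
    intervalIntegral.integral_Iic_sub_Iic hi.integrableOn hi.integrableOn,
    intervalIntegral.integral_of_le hab]

lemma osgt_neg (m σ y : ℝ) : osgt m σ (-y) = osgt m σ y := by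
  unfold osgt
  rcases lt_trichotomy y 0 with h | rfl | h
  · rw [if_neg (by linarith), if_pos h.le]
    ring_nf
  · simp
  · rw [if_pos (by linarith), if_neg (by linarith)]
    ring_nf

lemma exp_div_rpow_mul_exp_div_rpow {S : ℝ} (hS : 0 < S) (a b α : ℝ) :
    (Real.exp a / S) ^ α * (Real.exp b / S) ^ (1 - α) = Real.exp (α * a + (1 - α) * b) / S := by
  rw [Real.div_rpow (Real.exp_pos _).le hS.le, Real.div_rpow (Real.exp_pos _).le hS.le,
    div_mul_div_comm, ← Real.rpow_add hS, ← Real.exp_mul, ← Real.exp_mul, ← Real.exp_add]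
  norm_num [mul_comm]

/-- A weighted combination of two squares completes to a single square around the weighted
centre, so the product of powers of two Gaussians is again a Gaussian. -/
lemma gaussian_rpow_mul_gaussian_rpow {S : ℝ} (hS : 0 < S) (a b α σ y : ℝ) :
    (Real.exp (-(y - a) ^ 2 / (2 * σ ^ 2)) / S) ^ α *
        (Real.exp (-(y - b) ^ 2 / (2 * σ ^ 2)) / S) ^ (1 - α) =
      Real.exp (α * (α - 1) * (a - b) ^ 2 / (2 * σ ^ 2)) / S *
        Real.exp (-(y - (α * a + (1 - α) * b)) ^ 2 / (2 * σ ^ 2)) := by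
  rw [exp_div_rpow_mul_exp_div_rpow hS, div_mul_eq_mul_div, ← Real.exp_add]
  congr 2
  ring

/-- The Rényi integral when the second density is shifted to the right by `d`. -/
lemma integral_osgt_rpow_mul_osgt_rpow {m σ α d : ℝ} (hσ : 0 < σ) (hd : 0 < d) {S : ℝ}
    (hS : S = 2 * Real.sqrt (2 * Real.pi * σ ^ 2) * gaussQ (m / σ)) (hSpos : 0 < S) :
    ∫ y : ℝ, osgt m σ y ^ α * osgt m σ (y - d) ^ (1 - α) =
      Real.exp (α * (α - 1) * d ^ 2 / (2 * σ ^ 2)) * (Real.sqrt (2 * Real.pi * σ ^ 2) / S *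
        (stdPhi ((-m + (α - 1) * d) / σ) + stdPhi ((-m - α * d) / σ) +
          Real.exp (α * (α - 1) * (4 * m * d + 4 * m ^ 2) / (2 * σ ^ 2)) *
            (stdPhi ((α * d - m * (1 - 2 * α)) / σ) -
              stdPhi (((α - 1) * d - m * (1 - 2 * α)) / σ)))) := by
  set F : ℝ → ℝ := fun y => osgt m σ y ^ α * osgt m σ (y - d) ^ (1 - α) with hF
  set G : ℝ → ℝ → ℝ → ℝ := fun a b y =>
    Real.exp (α * (α - 1) * (a - b) ^ 2 / (2 * σ ^ 2)) / S *
      Real.exp (-(y - (α * a + (1 - α) * b)) ^ 2 / (2 * σ ^ 2)) with hG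
  have hGi (a b : ℝ) : Integrable (G a b) := (integrable_exp_neg_sub_sq_div _ hσ).const_mul _
  have hleft : EqOn (G m (d + m)) F (Iic 0) := by
    intro y hy
    simp only [mem_Iic] at hy
    simp only [hF, hG, osgt, ← hS, if_pos hy, if_pos (show y - d ≤ 0 by linarith),
      ← gaussian_rpow_mul_gaussian_rpow hSpos, sub_sub]
  have hmid : EqOn (G (-m) (d + m)) F (Ioc 0 d) := by
    intro y hy
    simp only [mem_Ioc] at hy
    simp only [hF, hG, osgt, ← hS, if_neg (not_le.2 hy.1), if_pos (show y - d ≤ 0 by linarith),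
      ← gaussian_rpow_mul_gaussian_rpow hSpos, sub_sub, sub_neg_eq_add]
  have hright : EqOn (G (-m) (d - m)) F (Ioi d) := by
    intro y hy
    simp only [mem_Ioi] at hy
    simp only [hF, hG, osgt, ← hS, if_neg (not_le.2 (hd.trans hy)),
      if_neg (show ¬ y - d ≤ 0 by linarith),
      ← gaussian_rpow_mul_gaussian_rpow hSpos, sub_neg_eq_add, sub_add]
  have hFl := (hGi m (d + m)).integrableOn.congr_fun hleft measurableSet_Iic
  have hFm := (hGi (-m) (d + m)).integrableOn.congr_fun hmid measurableSet_Ioc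
  have hFr := (hGi (-m) (d - m)).integrableOn.congr_fun hright measurableSet_Ioi
  have hunion : Ioc 0 d ∪ Ioi d = Ioi 0 := Ioc_union_Ioi_eq_Ioi hd.le
  have hFp : IntegrableOn F (Ioi 0) := hunion ▸ hFm.union hFr
  rw [← intervalIntegral.integral_Iic_add_Ioi hFl hFp, ← hunion,
    setIntegral_union (Ioc_disjoint_Ioi le_rfl) measurableSet_Ioi hFm hFr,
    ← setIntegral_congr_fun measurableSet_Iic hleft,
    ← setIntegral_congr_fun measurableSet_Ioc hmid,
    ← setIntegral_congr_fun measurableSet_Ioi hright]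
  simp only [hG, integral_const_mul]
  rw [setIntegral_Iic_exp_neg_sub_sq_div _ _ hσ, setIntegral_Ioc_exp_neg_sub_sq_div hd.le _ hσ,
    setIntegral_Ioi_exp_neg_sub_sq_div _ _ hσ,
    show α * (α - 1) * (-m - (d + m)) ^ 2 / (2 * σ ^ 2) = α * (α - 1) * d ^ 2 / (2 * σ ^ 2) +
      α * (α - 1) * (4 * m * d + 4 * m ^ 2) / (2 * σ ^ 2) by ring, Real.exp_add,
    show m - (d + m) = -d by ring, show -m - (d - m) = -d by ring, neg_sq,
    show 0 - (α * m + (1 - α) * (d + m)) = -m + (α - 1) * d by ring,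
    show d - (α * -m + (1 - α) * (d + m)) = α * d - m * (1 - 2 * α) by ring,
    show 0 - (α * -m + (1 - α) * (d + m)) = (α - 1) * d - m * (1 - 2 * α) by ring,
    show α * -m + (1 - α) * (d - m) - d = -m - α * d by ring]
  ring

lemma integral_osgt_shift (m σ α q q' : ℝ) :
    ∫ y : ℝ, osgt m σ (y - q) ^ α * osgt m σ (y - q') ^ (1 - α) =
      ∫ y : ℝ, osgt m σ y ^ α * osgt m σ (y - |q - q'|) ^ (1 - α) := by
  have h := integral_sub_right_eq_self (μ := volume)
    (fun y => osgt m σ y ^ α * osgt m σ (y - (q' - q)) ^ (1 - α)) q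
  simp only [show ∀ y : ℝ, y - q - (q' - q) = y - q' by intro y; ring]
    at h
  rw [h]
  rcases le_total q q' with hq | hq
  · rw [abs_of_nonpos (by linarith), neg_sub]
  · rw [abs_of_nonneg (by linarith), ← integral_neg_eq_self]
    congr 1
    ext y
    rw [osgt_neg, ← osgt_neg m σ (y - (q - q'))]
    ring_nf

/-- exact Rényi divergence of order `α` between two shifted OSGT densities. -/
theorem osgt_renyi_exact (m σ α : ℝ) (hm : 0 < m) (hσ : 0 < σ) (hα : 1 < α)
    (q q' : ℝ) (Δ' : ℝ) (hΔ' : Δ' = |q - q'|) (hΔpos : 0 < Δ')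
    (S : ℝ) (hS : S = 2 * Real.sqrt (2 * Real.pi * σ ^ 2) * gaussQ (m / σ))
    (B : ℝ)
    (hB : B = stdPhi ((-m + (α - 1) * Δ') / σ) + stdPhi ((-m - α * Δ') / σ) +
      Real.exp (α * (α - 1) * (4 * m * Δ' + 4 * m ^ 2) / (2 * σ ^ 2)) *
        (stdPhi ((α * Δ' - m * (1 - 2 * α)) / σ) -
          stdPhi (((α - 1) * Δ' - m * (1 - 2 * α)) / σ))) :
    (1 / (α - 1)) * Real.log (∫ y : ℝ, osgt m σ (y - q) ^ α * osgt m σ (y - q') ^ (1 - α)) =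
      α * Δ' ^ 2 / (2 * σ ^ 2) +
        (1 / (α - 1)) * Real.log ((Real.sqrt (2 * Real.pi * σ ^ 2) / S) * B) := by
  have hSpos : 0 < S := by
    have := gaussQ_pos (m / σ)
    rw [hS]
    positivity
  have hBpos : 0 < B := by
    have hmono : stdPhi (((α - 1) * Δ' - m * (1 - 2 * α)) / σ) ≤
        stdPhi ((α * Δ' - m * (1 - 2 * α)) / σ) :=
      stdPhi_mono (div_le_div_of_nonneg_right (by linarith) hσ.le)
    rw [hB]
    exact add_pos_of_pos_of_nonneg (add_pos (stdPhi_pos _) (stdPhi_pos _))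
      (mul_nonneg (Real.exp_pos _).le (sub_nonneg.2 hmono))
  have hα' : α - 1 ≠ 0 := by linarith
  rw [integral_osgt_shift, ← hΔ', integral_osgt_rpow_mul_osgt_rpow hσ hΔpos hS hSpos, ← hB,
    Real.log_mul (Real.exp_pos _).ne' (by positivity), Real.log_exp]
  field_simp
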